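/- arXiv:1608.08700 — 5 statements merged into one kernel-verified Lean document; each statement's English description precedes it below -/
import Mathlib

section
/- Let K be a field and V₁, V₂ finite-dimensional K-vector spaces equipped with exhaustive, separated, left-limit-closed ℚ-indexed decreasing filtrations F₁, F₂ (i.e., each Fᵢ : ℚ → Submodule K Vᵢ is antitone, equals Vᵢ for λ ≪ 0, equals 0 for λ ≫ 0, and satisfies Fᵢ(λ) = ⋂_{μ<λ} Fᵢ(μ)). Define the product filtration on V₁ ⊗_K V₂ by F(λ) = the span of all pure tensors v₁ ⊗ v₂ with v₁ ∈ F₁(a), v₂ ∈ F₂(b), a + b = λ (a, b ∈ ℚ). Then for every λ ∈ ℚ, dim_K Gr_F^λ (V₁ ⊗ V₂) = Σ_{a+b=λ} dim_K Gr_{F₁}^a V₁ · dim_K Gr_{F₂}^b V₂, where all graded pieces are defined by Gr^λ = F(λ)/(⋃_{μ>λ} F(μ)) and the sum has only finitely many nonzero terms. -/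
open Module TensorProduct

/-- The graded piece `Gr^λ V = F(λ) / (⋃_{μ > λ} F(μ))` of a decreasing `ℚ`-indexed
filtration `F` on `V`. -/
def gradedPiece {K V : Type*} [Field K] [AddCommGroup V] [Module K V]
    (F : ℚ → Submodule K V) (lam : ℚ) : Type _ :=
  (F lam) ⧸ (Submodule.comap (F lam).subtype (⨆ (μ : ℚ) (_ : lam < μ), F μ))

noncomputable instance {K V : Type*} [Field K] [AddCommGroup V] [Module K V]
    (F : ℚ → Submodule K V) (lam : ℚ) : AddCommGroup (gradedPiece F lam) :=
  inferInstanceAs (AddCommGroup ((F lam) ⧸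
    (Submodule.comap (F lam).subtype (⨆ (μ : ℚ) (_ : lam < μ), F μ))))

noncomputable instance {K V : Type*} [Field K] [AddCommGroup V] [Module K V]
    (F : ℚ → Submodule K V) (lam : ℚ) : Module K (gradedPiece F lam) :=
  inferInstanceAs (Module K ((F lam) ⧸
    (Submodule.comap (F lam).subtype (⨆ (μ : ℚ) (_ : lam < μ), F μ))))

/-- The product filtration on `V₁ ⊗ V₂` of two filtrations `F₁`, `F₂`:
`F(λ)` is the subspace generated by the pure tensors `v₁ ⊗ v₂` with `v₁ ∈ F₁ a`,
`v₂ ∈ F₂ b` and `a + b = λ`. -/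
noncomputable def productFiltration {K V₁ V₂ : Type*} [Field K]
    [AddCommGroup V₁] [Module K V₁] [AddCommGroup V₂] [Module K V₂]
    (F₁ : ℚ → Submodule K V₁) (F₂ : ℚ → Submodule K V₂) (lam : ℚ) :
    Submodule K (V₁ ⊗[K] V₂) :=
  ⨆ a : ℚ, Submodule.map₂ (TensorProduct.mk K V₁ V₂) (F₁ a) (F₂ (lam - a))

/-- A family of subspaces that is antitone in its index admits, inside any subspace `W`, a basis
`s` of `W` that restricts to a spanning set of each member contained in `W`. -/
theorem exists_linearIndepOn_adapted {K V : Type*} [Field K] [AddCommGroup V] [Module K V]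
    [FiniteDimensional K V] {F : ℚ → Submodule K V} (hF : Antitone F) (W : Submodule K V) :
    ∃ s : Set V, LinearIndepOn K id s ∧ Submodule.span K s = W ∧
      ∀ a, F a ≤ W → Submodule.span K (s ∩ F a) = F a := by
  induction W using WellFoundedLT.induction with
  | ind W ih =>
    obtain ⟨s', hs', hs'W, hs'F⟩ : ∃ s' : Set V, LinearIndepOn K id s' ∧ s' ⊆ W ∧
        ∀ a, F a < W → Submodule.span K (s' ∩ F a) = F a := by
      rcases Set.eq_empty_or_nonempty {U | U < W ∧ U ∈ Set.range F} with h | h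
      · refine ⟨∅, linearIndepOn_empty K id, Set.empty_subset _, fun a ha => ?_⟩
        exact (h.subset (show F a ∈ {U | U < W ∧ U ∈ Set.range F} from ⟨ha, a, rfl⟩)).elim
      · obtain ⟨_, ⟨hUW, c, rfl⟩, hmax⟩ := WellFounded.has_min
          (wellFounded_gt (α := Submodule K V)) _ h
        obtain ⟨s', hs', hspan, hs'F⟩ := ih (F c) hUW
        refine ⟨s', hs', ?_, fun a ha => hs'F a ?_⟩
        · exact (Submodule.subset_span.trans hspan.le).trans hUW.le
        · rcases le_total a c with hac | hac
          · by_contra hle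
            exact hmax (F a) ⟨ha, a, rfl⟩ (lt_of_le_not_ge (hF hac) hle)
          · exact hF hac
    obtain ⟨b, hbW, hsb, hWb, hb⟩ := exists_linearIndepOn_id_extension hs' hs'W
    have hspan : Submodule.span K b = W := le_antisymm (Submodule.span_le.2 hbW) hWb
    refine ⟨b, hb, hspan, fun a ha => ?_⟩
    rcases ha.eq_or_lt with h | h
    · rw [h, Set.inter_eq_left.2 hbW, hspan]
    · refine le_antisymm (Submodule.span_le.2 Set.inter_subset_right) ?_
      conv_lhs => rw [← hs'F a h]
      exact Submodule.span_mono (Set.inter_subset_inter_left _ hsb)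

/-- An antitone family of subspaces of a finite-dimensional space admits an adapted basis. -/
theorem exists_basis_adapted {K V : Type*} [Field K] [AddCommGroup V] [Module K V]
    [FiniteDimensional K V] {F : ℚ → Submodule K V} (hF : Antitone F) :
    ∃ (s : Set V) (e : Basis s K V), ∀ a, F a = Submodule.span K (e '' {i | e i ∈ F a}) := by
  obtain ⟨s, hs, hspan, hsF⟩ := exists_linearIndepOn_adapted hF ⊤
  let e : Basis s K V := Basis.mk (v := fun i : s => (i : V)) hs (by simp [hspan])
  have he : ∀ i, e i = (i : V) := fun i => Basis.mk_apply _ _ i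
  refine ⟨s, e, fun a => ?_⟩
  conv_lhs => rw [← hsF a le_top]
  congr 1
  ext v
  simp only [Set.mem_inter_iff, Set.mem_image, Set.mem_ofPred_eq, he, Subtype.exists,
    SetLike.mem_coe]
  grind

/-- The dimension of the span of a subfamily of a finite basis. -/
theorem finrank_span_basis_image {K V ι : Type*} [Field K] [AddCommGroup V] [Module K V]
    (e : Basis ι K V) (S : Set ι) :
    finrank K (Submodule.span K (e '' S)) = S.ncard := by
  have h := e.linearIndependent.linearIndepOn S
  rw [Module.finrank, rank_span_set h.id_image, ← Set.ncard_image_of_injective S e.injective]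
  rfl

/-- For a filtration spanned by parts of a finite basis, the dimension of a graded piece is the
number of basis vectors that disappear right after the given index. -/
theorem finrank_gradedPiece_of_basis {K V ι : Type*} [Field K] [AddCommGroup V] [Module K V]
    [Finite ι] (e : Basis ι K V) {F : ℚ → Submodule K V} {S : ℚ → Set ι} (hS : Antitone S)
    (hF : ∀ a, F a = Submodule.span K (e '' S a)) (lam : ℚ) :
    finrank K (gradedPiece F lam) = {i | i ∈ S lam ∧ ∀ μ, lam < μ → i ∉ S μ}.ncard := by
  have : FiniteDimensional K V := e.finiteDimensional_of_finite
  have hsup : (⨆ (μ : ℚ) (_ : lam < μ), F μ) =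
      Submodule.span K (e '' ⋃ (μ : ℚ) (_ : lam < μ), S μ) := by
    simp only [hF, Set.image_iUnion, Submodule.span_iUnion]
  have hsub : (⋃ (μ : ℚ) (_ : lam < μ), S μ) ⊆ S lam :=
    Set.iUnion₂_subset fun μ hμ => hS hμ.le
  have hle : (⨆ (μ : ℚ) (_ : lam < μ), F μ) ≤ F lam := by
    rw [hsup, hF lam]
    exact Submodule.span_mono (Set.image_mono hsub)
  have hquot := Submodule.finrank_quotient_add_finrank
    (Submodule.comap (F lam).subtype (⨆ (μ : ℚ) (_ : lam < μ), F μ))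
  rw [(Submodule.comapSubtypeEquivOfLe hle).finrank_eq, hsup, finrank_span_basis_image,
    hF lam, finrank_span_basis_image, ← Set.ncard_sdiff_add_ncard_of_subset hsub] at hquot
  have hdiff : S lam \ (⋃ (μ : ℚ) (_ : lam < μ), S μ) =
      {i | i ∈ S lam ∧ ∀ μ, lam < μ → i ∉ S μ} := by
    ext i
    simp
  rw [← hdiff, ← Nat.add_right_cancel hquot, ← hF lam, ← hsup]
  rfl

/-- The product of filtrations spanned by parts of bases is spanned by part of the tensor basis. -/
theorem productFiltration_eq_span {K V₁ V₂ ι κ : Type*} [Field K]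
    [AddCommGroup V₁] [Module K V₁] [AddCommGroup V₂] [Module K V₂]
    (e : Basis ι K V₁) (f : Basis κ K V₂)
    {F₁ : ℚ → Submodule K V₁} {F₂ : ℚ → Submodule K V₂} {S : ℚ → Set ι} {T : ℚ → Set κ}
    (h₁ : ∀ a, F₁ a = Submodule.span K (e '' S a)) (h₂ : ∀ a, F₂ a = Submodule.span K (f '' T a))
    (lam : ℚ) :
    productFiltration F₁ F₂ lam =
      Submodule.span K (e.tensorProduct f '' ⋃ a, S a ×ˢ T (lam - a)) := by
  simp only [productFiltration, h₁, h₂, Submodule.map₂_span_span, Set.image_iUnion,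
    Submodule.span_iUnion]
  refine iSup_congr fun a => congrArg _ ?_
  ext x
  simp only [Set.mem_image2, Set.mem_image, Set.mem_prod, Prod.exists, Basis.tensorProduct_apply,
    TensorProduct.mk_apply]
  grind

/-- Pairs that disappear right after `lam` from the sum of two decreasing families of sets are the
pairs of elements that disappear right after complementary indices. -/
theorem setOf_last_mem_prod {ι κ : Type*} {S : ℚ → Set ι} {T : ℚ → Set κ}
    (lam : ℚ) :
    {p : ι × κ | p ∈ ⋃ a, S a ×ˢ T (lam - a) ∧ ∀ μ, lam < μ → p ∉ ⋃ a, S a ×ˢ T (μ - a)} =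
      ⋃ a, {i | i ∈ S a ∧ ∀ μ, a < μ → i ∉ S μ} ×ˢ
        {j | j ∈ T (lam - a) ∧ ∀ μ, lam - a < μ → j ∉ T μ} := by
  ext ⟨i, j⟩
  simp only [Set.mem_ofPred_eq, Set.mem_iUnion, Set.mem_prod, not_exists, not_and]
  constructor
  · rintro ⟨⟨a, hi, hj⟩, hlast⟩
    refine ⟨a, ⟨hi, fun μ hμ hiμ => ?_⟩, hj, fun μ hμ hjμ => ?_⟩
    · exact hlast (lam - a + μ) (by linarith) μ hiμ (by simpa using hj)
    · exact hlast (μ + a) (by linarith) a hi (by simpa using hjμ)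
  · rintro ⟨a, ⟨hi, hi'⟩, hj, hj'⟩
    refine ⟨⟨a, hi, hj⟩, fun μ hμ c hic hjc => ?_⟩
    rcases lt_or_ge a c with hac | hac
    · exact hi' c hac hic
    · exact hj' (μ - c) (by linarith) hjc

/-- A disjoint family of subsets of a finite type has finitely many nonempty members, and the
cardinality of its union is the sum of their cardinalities. -/
theorem finite_support_and_ncard_iUnion {α β : Type*} [Finite β] {A : α → Set β}
    (hA : Pairwise (Function.onFun Disjoint A)) :
    {a | (A a).ncard ≠ 0}.Finite ∧ (⋃ a, A a).ncard = ∑ᶠ a, (A a).ncard := by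
  have hfin : {a | (A a).ncard ≠ 0}.Finite := by
    have hne : ∀ a : {a | (A a).ncard ≠ 0}, (A a).Nonempty := fun a =>
      Set.nonempty_of_ncard_ne_zero a.2
    choose g hg using hne
    refine Set.finite_coe_iff.1 (Finite.of_injective g fun a b hab => ?_)
    by_contra h
    exact Set.disjoint_left.1 (hA fun h' => h (Subtype.ext h')) (hg a) (hab ▸ hg b)
  refine ⟨hfin, ?_⟩
  have hU : ⋃ a, A a = ⋃ a ∈ {a | (A a).ncard ≠ 0}, A a := by
    ext x
    simp only [Set.mem_iUnion, Set.mem_ofPred_eq, exists_prop]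
    exact exists_congr fun a => ⟨fun h => ⟨Set.ncard_ne_zero_of_mem h, h⟩, And.right⟩
  rw [hU, hfin.ncard_biUnion (fun _ _ => Set.toFinite _) (hA.set_pairwise _)]
  exact finsum_mem_support _

/-- Künneth formula for the graded pieces of the product filtration: the dimension of the
`λ`-graded piece of the product filtration on `V₁ ⊗ V₂` is
`∑_{a+b=λ} dim Gr^a V₁ · dim Gr^b V₂`, and the sum has finitely many nonzero terms. -/
theorem gradedPiece_productFiltration_finrank
    (K V₁ V₂ : Type*) [Field K]
    [AddCommGroup V₁] [Module K V₁] [FiniteDimensional K V₁]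
    [AddCommGroup V₂] [Module K V₂] [FiniteDimensional K V₂]
    (F₁ : ℚ → Submodule K V₁) (F₂ : ℚ → Submodule K V₂)
    (hF₁ : Antitone F₁) (hF₂ : Antitone F₂)
    (hexh₁ : ∃ a : ℚ, ∀ lam ≤ a, F₁ lam = ⊤)
    (hexh₂ : ∃ a : ℚ, ∀ lam ≤ a, F₂ lam = ⊤)
    (hsep₁ : ∃ b : ℚ, ∀ lam ≥ b, F₁ lam = ⊥)
    (hsep₂ : ∃ b : ℚ, ∀ lam ≥ b, F₂ lam = ⊥)
    (hll₁ : ∀ lam : ℚ, F₁ lam = ⨅ (μ : ℚ) (_ : μ < lam), F₁ μ)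
    (hll₂ : ∀ lam : ℚ, F₂ lam = ⨅ (μ : ℚ) (_ : μ < lam), F₂ μ) :
    ∀ lam : ℚ,
      {a : ℚ | finrank K (gradedPiece F₁ a) * finrank K (gradedPiece F₂ (lam - a)) ≠ 0}.Finite ∧
      finrank K (gradedPiece (productFiltration F₁ F₂) lam) =
        ∑ᶠ a : ℚ, finrank K (gradedPiece F₁ a) * finrank K (gradedPiece F₂ (lam - a)) := by
  intro lam
  obtain ⟨s, e, he⟩ := exists_basis_adapted hF₁
  obtain ⟨t, f, hf⟩ := exists_basis_adapted hF₂
  have : Finite s := Module.Finite.finite_basis e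
  have : Finite t := Module.Finite.finite_basis f
  set S : ℚ → Set s := fun a => {i | e i ∈ F₁ a}
  set T : ℚ → Set t := fun a => {j | f j ∈ F₂ a}
  have hS : Antitone S := fun a b hab i hi => hF₁ hab hi
  have hT : Antitone T := fun a b hab j hj => hF₂ hab hj
  have hST : Antitone fun lam => ⋃ a, S a ×ˢ T (lam - a) := fun x y hxy =>
    Set.iUnion_mono fun a => Set.prod_mono_right (hT (by linarith))
  rw [finrank_gradedPiece_of_basis (e.tensorProduct f) hST (productFiltration_eq_span e f he hf),
    setOf_last_mem_prod]
  simp only [finrank_gradedPiece_of_basis e hS he, finrank_gradedPiece_of_basis f hT hf,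
    ← Set.ncard_prod]
  exact finite_support_and_ncard_iUnion (fun a b hab => Set.disjoint_left.2 (by
    rintro ⟨i, j⟩ ⟨⟨hia, hia'⟩, -⟩ ⟨⟨hib, hib'⟩, -⟩
    rcases lt_or_gt_of_ne hab with h | h
    · exact hia' b h hib
    · exact hib' a h hia))
end

section
/- For every nonconstant polynomial f ∈ ℂ[x], the ℂ-linear map T_f : ℂ[x] → ℂ[x] defined by T_f(g) = g' + f'·g (where ' denotes the formal derivative) is injective, and its cokernel ℂ[x]/range(T_f) is a ℂ-vector space of dimension deg(f) − 1. -/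
open Polynomial Module

section TwistedDerivative

variable {K : Type*} [Field K] {h : K[X]}

/-- Adding `g'` to `h * g` does not change its degree. -/
theorem degree_derivative_add_mul (hh : h ≠ 0) (g : K[X]) :
    (derivative g + h * g).degree = h.degree + g.degree := by
  rcases eq_or_ne g 0 with rfl | hg
  · simp
  · rw [degree_add_eq_right_of_degree_lt, degree_mul]
    rw [mul_comm]
    exact (degree_derivative_lt hg).trans_le (degree_le_mul_left g hh)

variable {T : K[X] →ₗ[K] K[X]}

theorem injective_of_eq_derivative_add_mul (hh : h ≠ 0)
    (hT : ∀ g, T g = derivative g + h * g) : Function.Injective T := by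
  refine (injective_iff_map_eq_zero T).2 fun g hg => ?_
  have hdeg := degree_derivative_add_mul hh g
  rw [← hT, hg, degree_zero, eq_comm, WithBot.add_eq_bot] at hdeg
  exact degree_eq_bot.1 (hdeg.resolve_left (mt degree_eq_bot.1 hh))

/-- Division with remainder by the operator `g ↦ g' + h * g`. -/
theorem exists_degree_sub_lt_of_eq_derivative_add_mul (hh : h ≠ 0)
    (hT : ∀ g, T g = derivative g + h * g) (p : K[X]) :
    ∃ g, (p - T g).degree < h.degree := by
  induction hd : p.degree using WellFoundedLT.induction generalizing p with
  | ind d ih =>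
    subst hd
    rcases lt_or_ge p.degree h.degree with hlt | hle
    · exact ⟨0, by simpa using hlt⟩
    · have hp : p ≠ 0 := by
        rintro rfl
        exact hh (degree_eq_bot.1 (le_bot_iff.1 (by simpa using hle)))
      have hq : (derivative (p / h)).degree < p.degree := by
        rcases eq_or_ne (p / h) 0 with h0 | h0
        · rw [h0, derivative_zero, degree_zero]
          exact bot_lt_iff_ne_bot.2 (mt degree_eq_bot.1 hp)
        · exact (degree_derivative_lt h0).trans_le (degree_div_le p h)
      have hsub : p - T (p / h) = p % h - derivative (p / h) := by
        rw [hT]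
        linear_combination -EuclideanDomain.div_add_mod p h
      have hlt : (p - T (p / h)).degree < p.degree := by
        rw [hsub]
        exact (degree_sub_le _ _).trans_lt
          (max_lt ((degree_mod_lt p hh).trans_le hle) hq)
      obtain ⟨g, hg⟩ := ih _ hlt _ rfl
      exact ⟨p / h + g, by rwa [map_add, ← sub_sub]⟩

theorem isCompl_range_degreeLT_of_eq_derivative_add_mul (hh : h ≠ 0)
    (hT : ∀ g, T g = derivative g + h * g) :
    IsCompl (LinearMap.range T) (degreeLT K h.natDegree) := by
  constructor
  · rw [Submodule.disjoint_def]
    rintro _ ⟨g, rfl⟩ hg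
    rw [mem_degreeLT, ← degree_eq_natDegree hh, hT, degree_derivative_add_mul hh] at hg
    rcases eq_or_ne g 0 with rfl | hg0
    · exact map_zero T
    · rw [degree_eq_natDegree hh, degree_eq_natDegree hg0] at hg
      norm_cast at hg
      lia
  · rw [codisjoint_iff, eq_top_iff]
    intro p _
    obtain ⟨g, hg⟩ := exists_degree_sub_lt_of_eq_derivative_add_mul hh hT p
    refine Submodule.mem_sup.2 ⟨T g, ⟨g, rfl⟩, p - T g, ?_, add_sub_cancel _ _⟩
    rwa [mem_degreeLT, ← degree_eq_natDegree hh]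

theorem finrank_quotient_range_of_eq_derivative_add_mul (hh : h ≠ 0)
    (hT : ∀ g, T g = derivative g + h * g) :
    finrank K (K[X] ⧸ LinearMap.range T) = h.natDegree := by
  rw [(Submodule.quotientEquivOfIsCompl _ _
      (isCompl_range_degreeLT_of_eq_derivative_add_mul hh hT)).finrank_eq,
    (degreeLTEquiv K h.natDegree).finrank_eq, finrank_fin_fun]

end TwistedDerivative

/-- For a nonconstant polynomial `f ∈ ℂ[x]`, the twisted de Rham differential
`T_f(g) = g' + f'·g` on `ℂ[x]` is injective and its cokernel has dimension `deg f − 1`.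
This computes `H⁰_dR(𝔸¹, f) = 0` and `dim H¹_dR(𝔸¹, f) = deg f − 1`. -/
theorem twisted_deRham_affine_line
    (f : Polynomial ℂ) (hf : 1 ≤ f.natDegree)
    (T : Polynomial ℂ →ₗ[ℂ] Polynomial ℂ)
    (hT : ∀ g : Polynomial ℂ, T g = derivative g + derivative f * g) :
    Function.Injective T ∧
      finrank ℂ (Polynomial ℂ ⧸ LinearMap.range T) = f.natDegree - 1 := by
  have hf' : derivative f ≠ 0 := by
    rw [Ne, derivative_eq_zero]
    lia
  refine ⟨injective_of_eq_derivative_add_mul hf' hT, ?_⟩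
  rw [finrank_quotient_range_of_eq_derivative_add_mul hf' hT, natDegree_derivative]
end

section
/- Let f, g ∈ ℂ[x] be nonconstant polynomials. In A = ℂ[x, y] (multivariate polynomials in two variables over ℂ), define ℂ-linear maps D₀ : A → A × A, D₀(h) = (∂ₓh + f'(x)·h, ∂ᵧh + g'(y)·h), and D₁ : A × A → A, D₁(h₁, h₂) = (∂ₓh₂ + f'(x)·h₂) − (∂ᵧh₁ + g'(y)·h₁). Then D₁ ∘ D₀ = 0, D₀ is injective, and the kernel of D₁ equals the range of D₀. -/
open Polynomial MvPolynomial

namespace TwistedDeRham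

theorem degree_derivative_add_mul {R : Type*} [CommRing R] [IsDomain R] {F : R[X]} (hF : F ≠ 0)
    (w : R[X]) : (derivative w + F * w).degree = F.degree + w.degree := by
  rcases eq_or_ne w 0 with rfl | hw
  · simp
  rw [← Polynomial.degree_mul]
  refine degree_add_eq_right_of_degree_lt ((degree_derivative_lt hw).trans_le ?_)
  rw [mul_comm]
  exact Polynomial.degree_le_mul_left w hF

theorem derivative_add_mul_eq_zero {R : Type*} [CommRing R] [IsDomain R] {F w : R[X]}
    (hF : F ≠ 0) (h : derivative w + F * w = 0) : w = 0 := by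
  have hd := degree_derivative_add_mul hF w
  rw [h, Polynomial.degree_zero, eq_comm, WithBot.add_eq_bot] at hd
  simpa [hF] using hd

theorem exists_eq_derivative_add_mul_add {R : Type*} [CommRing R] [IsDomain R] {F : R[X]}
    (hF : IsUnit F.leadingCoeff) (h : R[X]) :
    ∃ q r : R[X], h = derivative q + F * q + r ∧ r.degree < F.degree := by
  obtain ⟨u, hu⟩ := hF
  have hM : (F * Polynomial.C (↑u⁻¹ : R)).Monic := by
    simp [Polynomial.Monic, ← hu]
  have hMd : (F * Polynomial.C (↑u⁻¹ : R)).degree = F.degree := by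
    rw [Polynomial.degree_mul, Polynomial.degree_C u⁻¹.ne_zero, add_zero]
  induction hn : h.degree using WellFoundedLT.induction generalizing h with
  | ind n ih =>
    subst hn
    set q := Polynomial.C (↑u⁻¹ : R) * (h /ₘ (F * Polynomial.C (↑u⁻¹ : R))) with hq
    set r := h %ₘ (F * Polynomial.C (↑u⁻¹ : R))
    have hdiv : r + F * q = h := by
      rw [hq, ← mul_assoc]
      exact modByMonic_add_div h _
    have hrd : r.degree < F.degree := hMd ▸ degree_modByMonic_lt h hM
    rcases eq_or_ne q 0 with hq0 | hq0
    · exact ⟨0, r, by simp [← hdiv, hq0], hrd⟩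
    have hlt : (-derivative q).degree < h.degree := by
      rw [Polynomial.degree_neg]
      refine (degree_derivative_lt hq0).trans_le ?_
      rw [hq, Polynomial.degree_mul, Polynomial.degree_C u⁻¹.ne_zero, zero_add]
      exact degree_divByMonic_le _ _
    obtain ⟨q', r', h', hr'⟩ := ih _ hlt _ rfl
    refine ⟨q + q', r + r', ?_, (Polynomial.degree_add_le _ _).trans_lt (max_lt hrd hr')⟩
    rw [derivative_add]
    linear_combination h' - hdiv

/-- The isomorphism `k[x, y] ≃ k[y][x]`. -/
noncomputable def toIterated (k : Type*) [CommRing k] :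
    MvPolynomial (Fin 2) k ≃ₐ[k] k[X][X] :=
  AlgEquiv.ofAlgHom (MvPolynomial.aeval ![Polynomial.X, Polynomial.C Polynomial.X])
    (Polynomial.aevalTower (Polynomial.aeval (MvPolynomial.X 1)) (MvPolynomial.X 0))
    (by ext <;> simp) (by ext i; fin_cases i <;> simp)

section

variable {k : Type*} [CommRing k]

@[simp]
theorem toIterated_X_zero : toIterated k (MvPolynomial.X 0) = Polynomial.X := by
  simp [toIterated]

@[simp]
theorem toIterated_X_one : toIterated k (MvPolynomial.X 1) = Polynomial.C Polynomial.X := by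
  simp [toIterated]

@[simp]
theorem toIterated_C (a : k) :
    toIterated k (MvPolynomial.C a) = Polynomial.C (Polynomial.C a) := by
  simp [toIterated, Polynomial.algebraMap_apply]

theorem toIterated_aeval_X_zero (p : k[X]) :
    toIterated k (Polynomial.aeval (MvPolynomial.X 0) p) = p.map Polynomial.C := by
  induction p using Polynomial.induction_on' with
  | add p q hp hq => simp [hp, hq]
  | monomial n a =>
    simp [← Polynomial.C_mul_X_pow_eq_monomial, MvPolynomial.algebraMap_eq]

theorem toIterated_aeval_X_one (p : k[X]) :
    toIterated k (Polynomial.aeval (MvPolynomial.X 1) p) = Polynomial.C p := by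
  induction p using Polynomial.induction_on' with
  | add p q hp hq => simp [hp, hq]
  | monomial n a =>
    simp [← Polynomial.C_mul_X_pow_eq_monomial, MvPolynomial.algebraMap_eq]

theorem toIterated_pderiv_zero (h : MvPolynomial (Fin 2) k) :
    toIterated k (pderiv 0 h) = derivative (toIterated k h) := by
  induction h using MvPolynomial.induction_on with
  | C a => simp
  | add p q hp hq => simp [hp, hq]
  | mul_X p i hp => fin_cases i <;> simp [hp, pderiv_X] <;> ring

theorem coeff_toIterated_pderiv_one (h : MvPolynomial (Fin 2) k) (n : ℕ) :
    (toIterated k (pderiv 1 h)).coeff n = derivative ((toIterated k h).coeff n) := by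
  induction h using MvPolynomial.induction_on generalizing n with
  | C a => simp [Polynomial.coeff_C]; split_ifs <;> simp
  | add p q hp hq => simp [hp, hq]
  | mul_X p i hp =>
    fin_cases i
    · cases n <;> simp [hp, pderiv_X, mul_comm (Polynomial.X : k[X][X])]
    · simp [hp, pderiv_X]; ring

end

/-- The twisted partial derivative `h ↦ ∂ₓh + φ(x)h` on `k[x, y]`. -/
noncomputable abbrev twistX {k : Type*} [CommRing k] (φ : k[X]) (h : MvPolynomial (Fin 2) k) :
    MvPolynomial (Fin 2) k :=
  pderiv 0 h + Polynomial.aeval (MvPolynomial.X 0) φ * h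

/-- The twisted partial derivative `h ↦ ∂ᵧh + ψ(y)h` on `k[x, y]`. -/
noncomputable abbrev twistY {k : Type*} [CommRing k] (ψ : k[X]) (h : MvPolynomial (Fin 2) k) :
    MvPolynomial (Fin 2) k :=
  pderiv 1 h + Polynomial.aeval (MvPolynomial.X 1) ψ * h

theorem pderiv_aeval_X_of_ne {k σ : Type*} [CommRing k] {i j : σ} (hij : i ≠ j) (p : k[X]) :
    pderiv i (Polynomial.aeval (MvPolynomial.X j : MvPolynomial σ k) p) = 0 := by
  classical
  induction p using Polynomial.induction_on' with
  | add p q hp hq => simp [hp, hq]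
  | monomial n a =>
    simp [← Polynomial.C_mul_X_pow_eq_monomial, MvPolynomial.algebraMap_eq, pderiv_X, hij.symm]

theorem twistX_twistY {k : Type*} [CommRing k] (φ ψ : k[X]) (h : MvPolynomial (Fin 2) k) :
    twistX φ (twistY ψ h) = twistY ψ (twistX φ h) := by
  have hc : pderiv 0 (pderiv 1 h) = pderiv 1 (pderiv 0 h) := by
    apply (toIterated k).injective
    ext1 n
    simp [toIterated_pderiv_zero, coeff_toIterated_pderiv_one, Polynomial.coeff_derivative]
  simp only [twistX, twistY, map_add, Derivation.leibniz, smul_eq_mul, hc,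
    pderiv_aeval_X_of_ne (zero_ne_one' (Fin 2)), pderiv_aeval_X_of_ne (zero_ne_one' (Fin 2)).symm]
  ring

theorem toIterated_twistX {k : Type*} [CommRing k] (φ : k[X]) (h : MvPolynomial (Fin 2) k) :
    toIterated k (twistX φ h) =
      derivative (toIterated k h) + φ.map Polynomial.C * toIterated k h := by
  simp [toIterated_pderiv_zero, toIterated_aeval_X_zero]

theorem coeff_toIterated_twistY {k : Type*} [CommRing k] (ψ : k[X])
    (h : MvPolynomial (Fin 2) k) (n : ℕ) :
    (toIterated k (twistY ψ h)).coeff n =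
      derivative ((toIterated k h).coeff n) + ψ * (toIterated k h).coeff n := by
  simp [coeff_toIterated_pderiv_one, toIterated_aeval_X_one]

theorem degree_toIterated_twistY_le {k : Type*} [CommRing k] (ψ : k[X])
    (h : MvPolynomial (Fin 2) k) :
    (toIterated k (twistY ψ h)).degree ≤ (toIterated k h).degree := by
  rw [Polynomial.degree_le_iff_coeff_zero]
  intro n hn
  rw [coeff_toIterated_twistY, Polynomial.coeff_eq_zero_of_degree_lt hn, derivative_zero,
    mul_zero, add_zero]

theorem twistX_eq_zero {k : Type*} [CommRing k] [IsDomain k] {φ : k[X]} (hφ : φ ≠ 0)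
    {h : MvPolynomial (Fin 2) k} (hh : twistX φ h = 0) : h = 0 := by
  have hφ' : φ.map (Polynomial.C : k →+* k[X]) ≠ 0 :=
    (Polynomial.map_ne_zero_iff Polynomial.C_injective).2 hφ
  apply (toIterated k).injective
  rw [map_zero]
  exact derivative_add_mul_eq_zero hφ' (by rw [← toIterated_twistX, hh, map_zero])

theorem twistY_eq_zero {k : Type*} [CommRing k] [IsDomain k] {ψ : k[X]} (hψ : ψ ≠ 0)
    {h : MvPolynomial (Fin 2) k} (hh : twistY ψ h = 0) : h = 0 := by
  apply (toIterated k).injective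
  ext1 n
  rw [map_zero, Polynomial.coeff_zero]
  exact derivative_add_mul_eq_zero hψ (by rw [← coeff_toIterated_twistY, hh]; simp)

theorem exists_twistX_twistY_eq {k : Type*} [Field k] {φ ψ : k[X]} (hφ : φ ≠ 0) (hψ : ψ ≠ 0)
    {h₁ h₂ : MvPolynomial (Fin 2) k} (h : twistX φ h₂ = twistY ψ h₁) :
    ∃ a, twistX φ a = h₁ ∧ twistY ψ a = h₂ := by
  have hφ' : φ.map (Polynomial.C : k →+* k[X]) ≠ 0 :=
    (Polynomial.map_ne_zero_iff Polynomial.C_injective).2 hφ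
  have hu : IsUnit (φ.map (Polynomial.C : k →+* k[X])).leadingCoeff := by
    rw [Polynomial.leadingCoeff_map_of_injective Polynomial.C_injective]
    exact Polynomial.isUnit_C.2 (Polynomial.leadingCoeff_ne_zero.2 hφ).isUnit
  obtain ⟨q, s, hqs, hs⟩ := exists_eq_derivative_add_mul_add hu (toIterated k h₁)
  obtain ⟨a, rfl⟩ := (toIterated k).surjective q
  obtain ⟨r, rfl⟩ := (toIterated k).surjective s
  rw [← toIterated_twistX, ← map_add] at hqs
  obtain rfl := (toIterated k).injective hqs
  have hw : twistX φ (h₂ - twistY ψ a) = twistY ψ r := by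
    have hc := twistX_twistY φ ψ a
    simp only [twistX, twistY, map_sub, map_add] at h hc ⊢
    linear_combination h - hc
  have hw0 : h₂ - twistY ψ a = 0 := by
    by_contra hne
    have hd := degree_derivative_add_mul hφ' (toIterated k (h₂ - twistY ψ a))
    rw [← toIterated_twistX, hw] at hd
    have hlt := (degree_toIterated_twistY_le ψ r).trans_lt hs
    refine hlt.not_ge (hd ▸ le_add_of_nonneg_right ?_)
    exact Polynomial.zero_le_degree_iff.2 ((map_ne_zero_iff _ (toIterated k).injective).2 hne)
  have hr : r = 0 := by
    refine twistY_eq_zero hψ ?_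
    rw [← hw, hw0]
    simp [twistX]
  exact ⟨a, by simp [hr], (sub_eq_zero.1 hw0).symm⟩

end TwistedDeRham

/-- Künneth in degrees 0 and 1 for the product pair `(𝔸², f(x) + g(y))`:
for nonconstant `f, g ∈ ℂ[x]`, with `A = ℂ[x, y]`,
`D₀(h) = (∂ₓh + f'(x)h, ∂ᵧh + g'(y)h)` and
`D₁(h₁, h₂) = (∂ₓh₂ + f'(x)h₂) − (∂ᵧh₁ + g'(y)h₁)`,
one has `D₁ ∘ D₀ = 0`, `D₀` injective and `ker D₁ = range D₀`;
i.e. `H⁰_dR(𝔸², f+g) = 0` and `H¹_dR(𝔸², f+g) = 0`. -/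
theorem twisted_deRham_kunneth_low_degrees
    (f g : Polynomial ℂ) (hf : 1 ≤ f.natDegree) (hg : 1 ≤ g.natDegree)
    (D₀ : MvPolynomial (Fin 2) ℂ →ₗ[ℂ] MvPolynomial (Fin 2) ℂ × MvPolynomial (Fin 2) ℂ)
    (D₁ : MvPolynomial (Fin 2) ℂ × MvPolynomial (Fin 2) ℂ →ₗ[ℂ] MvPolynomial (Fin 2) ℂ)
    (hD₀ : ∀ h : MvPolynomial (Fin 2) ℂ,
      D₀ h = (pderiv (0 : Fin 2) h + Polynomial.aeval (X (0 : Fin 2)) (derivative f) * h,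
              pderiv (1 : Fin 2) h + Polynomial.aeval (X (1 : Fin 2)) (derivative g) * h))
    (hD₁ : ∀ h₁ h₂ : MvPolynomial (Fin 2) ℂ,
      D₁ (h₁, h₂) =
        (pderiv (0 : Fin 2) h₂ + Polynomial.aeval (X (0 : Fin 2)) (derivative f) * h₂) -
        (pderiv (1 : Fin 2) h₁ + Polynomial.aeval (X (1 : Fin 2)) (derivative g) * h₁)) :
    D₁ ∘ₗ D₀ = 0 ∧ Function.Injective D₀ ∧ LinearMap.ker D₁ = LinearMap.range D₀ := by
  have hf' : derivative f ≠ 0 := fun h => by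
    have := Polynomial.derivative_eq_zero.1 h
    omega
  have hg' : derivative g ≠ 0 := fun h => by
    have := Polynomial.derivative_eq_zero.1 h
    omega
  have hcomp : D₁ ∘ₗ D₀ = 0 := by
    refine LinearMap.ext fun h => ?_
    rw [LinearMap.comp_apply, hD₀, hD₁]
    exact sub_eq_zero.2 (TwistedDeRham.twistX_twistY (derivative f) (derivative g) h)
  refine ⟨hcomp, ?_, le_antisymm ?_ (LinearMap.range_le_ker_iff.2 hcomp)⟩
  · refine (injective_iff_map_eq_zero D₀).2 fun h hh => ?_
    rw [hD₀] at hh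
    exact TwistedDeRham.twistX_eq_zero hf' (Prod.ext_iff.1 hh).1
  · rintro ⟨h₁, h₂⟩ hh
    rw [LinearMap.mem_ker, hD₁] at hh
    obtain ⟨a, rfl, rfl⟩ := TwistedDeRham.exists_twistX_twistY_eq hf' hg' (sub_eq_zero.1 hh)
    exact ⟨a, hD₀ a⟩
end

section
/- Let f, g ∈ ℂ[x] be nonconstant polynomials, A = ℂ[x, y], T_f(p) = p' + f'·p on ℂ[x], T_g(q) = q' + g'·q on ℂ[x], and D₁ : A × A → A, D₁(h₁, h₂) = (∂ₓh₂ + f'(x)·h₂) − (∂ᵧh₁ + g'(y)·h₁). Then the ℂ-bilinear map ℂ[x] × ℂ[x] → A/range(D₁) sending (p, q) to the class of p(x)·q(y) descends to a ℂ-linear isomorphism coker(T_f) ⊗_ℂ coker(T_g) ≅ A/range(D₁). In particular, dim_ℂ (A/range(D₁)) = (deg f − 1)·(deg g − 1). -/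
open Polynomial MvPolynomial TensorProduct Module

/-- The cokernel of `p ↦ p' + a * p` has dimension `a.natDegree`: polynomials of degree less than
`a.natDegree` form a complement of the range. -/
theorem finrank_quotient_range_derivative_add_mul {K : Type*} [Field K] {a : Polynomial K}
    (ha : a ≠ 0) (T : Polynomial K →ₗ[K] Polynomial K)
    (hT : ∀ p, T p = derivative p + a * p) :
    finrank K (Polynomial K ⧸ LinearMap.range T) = a.natDegree := by
  have hcompl : IsCompl (LinearMap.range T) (degreeLT K a.natDegree) := by
    constructor
    · rw [Submodule.disjoint_def]
      rintro _ ⟨p, rfl⟩ hp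
      by_cases hp0 : p = 0
      · simp [hp0]
      have hlt : (derivative p).degree < (a * p).degree :=
        (degree_derivative_lt hp0).trans_le (by
          rw [mul_comm]; exact degree_le_mul_left p ha)
      rw [mem_degreeLT, hT, degree_add_eq_right_of_degree_lt hlt,
        ← degree_eq_natDegree ha] at hp
      exact absurd hp (degree_le_mul_left a hp0).not_gt
    · rw [codisjoint_iff, Submodule.eq_top_iff']
      intro p
      induction h : p.degree using WellFoundedLT.induction generalizing p with
      | _ d ih =>
        subst h
        have hr : p % a ∈ LinearMap.range T ⊔ degreeLT K a.natDegree :=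
          Submodule.mem_sup_right (by
            rw [mem_degreeLT, ← degree_eq_natDegree ha]
            exact EuclideanDomain.mod_lt p ha)
        by_cases hq : p / a = 0
        · rw [← EuclideanDomain.div_add_mod p a, hq, mul_zero, zero_add]
          exact hr
        have hd := ih _ ((degree_derivative_lt hq).trans_le (degree_div_le p a)) _ rfl
        have hdecomp : p = T (p / a) + (p % a - derivative (p / a)) := by
          rw [hT]
          linear_combination -EuclideanDomain.div_add_mod p a
        rw [hdecomp]
        exact add_mem (Submodule.mem_sup_left ⟨_, rfl⟩) (sub_mem hr hd)
  rw [(Submodule.quotientEquivOfIsCompl _ _ hcompl).finrank_eq,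
    (degreeLTEquiv K a.natDegree).finrank_eq, finrank_fin_fun]

/-- The isomorphism `K[x] ⊗ K[y] ≃ K[x, y]`. -/
noncomputable def polynomialTensorEquiv (K : Type*) [Field K] :
    Polynomial K ⊗[K] Polynomial K ≃ₗ[K] MvPolynomial (Fin 2) K :=
  ((Polynomial.basisMonomials K).tensorProduct (Polynomial.basisMonomials K)).equiv
    (MvPolynomial.basisMonomials (Fin 2) K)
    ((finTwoArrowEquiv ℕ).symm.trans Finsupp.equivFunOnFinite.symm)

theorem polynomialTensorEquiv_tmul {K : Type*} [Field K] (p q : Polynomial K) :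
    polynomialTensorEquiv K (p ⊗ₜ q) =
      Polynomial.aeval (X (0 : Fin 2)) p * Polynomial.aeval (X (1 : Fin 2)) q := by
  have h : (TensorProduct.mk K _ _).compr₂ (polynomialTensorEquiv K).toLinearMap =
      (LinearMap.mul K (MvPolynomial (Fin 2) K)).compl₁₂
        (Polynomial.aeval (X (0 : Fin 2))).toLinearMap
        (Polynomial.aeval (X (1 : Fin 2))).toLinearMap := by
    refine (Polynomial.basisMonomials K).ext fun i => (Polynomial.basisMonomials K).ext fun j => ?_
    have hb := ((Polynomial.basisMonomials K).tensorProduct (Polynomial.basisMonomials K)).equiv_apply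
      (i, j) (MvPolynomial.basisMonomials (Fin 2) K)
      ((finTwoArrowEquiv ℕ).symm.trans Finsupp.equivFunOnFinite.symm)
    rw [Basis.tensorProduct_apply] at hb
    refine hb.trans ?_
    simp [MvPolynomial.monomial_eq, Finsupp.prod_fintype, Polynomial.aeval_monomial]
  exact LinearMap.congr_fun₂ h p q

theorem MvPolynomial.pderiv_aeval_X {R σ : Type*} [CommSemiring R] [DecidableEq σ] (i j : σ)
    (p : Polynomial R) :
    pderiv i (Polynomial.aeval (X j : MvPolynomial σ R) p) =
      if i = j then Polynomial.aeval (X j) (derivative p) else 0 := by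
  rw [Derivation.map_aeval, pderiv_X]
  rcases eq_or_ne i j with rfl | h
  · simp
  · simp [h, h.symm]

/-- Künneth in top degree for the product pair `(𝔸², f(x) + g(y))`: the bilinear map
`(p, q) ↦ [p(x)·q(y)]` descends to a `ℂ`-linear isomorphism
`coker T_f ⊗ coker T_g ≅ A / range D₁`, i.e.
`H¹_dR(𝔸¹, f) ⊗ H¹_dR(𝔸¹, g) ≅ H²_dR(𝔸², f+g)`; in particular
`dim H²_dR(𝔸², f+g) = (deg f − 1)(deg g − 1)`. -/
theorem twisted_deRham_kunneth_top_degree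
    (f g : Polynomial ℂ) (hf : 1 ≤ f.natDegree) (hg : 1 ≤ g.natDegree)
    (Tf Tg : Polynomial ℂ →ₗ[ℂ] Polynomial ℂ)
    (hTf : ∀ p : Polynomial ℂ, Tf p = derivative p + derivative f * p)
    (hTg : ∀ q : Polynomial ℂ, Tg q = derivative q + derivative g * q)
    (D₁ : MvPolynomial (Fin 2) ℂ × MvPolynomial (Fin 2) ℂ →ₗ[ℂ] MvPolynomial (Fin 2) ℂ)
    (hD₁ : ∀ h₁ h₂ : MvPolynomial (Fin 2) ℂ,
      D₁ (h₁, h₂) =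
        (pderiv (0 : Fin 2) h₂ + Polynomial.aeval (X (0 : Fin 2)) (derivative f) * h₂) -
        (pderiv (1 : Fin 2) h₁ + Polynomial.aeval (X (1 : Fin 2)) (derivative g) * h₁)) :
    (∃ e : ((Polynomial ℂ ⧸ LinearMap.range Tf) ⊗[ℂ] (Polynomial ℂ ⧸ LinearMap.range Tg))
        ≃ₗ[ℂ] (MvPolynomial (Fin 2) ℂ ⧸ LinearMap.range D₁),
      ∀ p q : Polynomial ℂ,
        e (Submodule.Quotient.mk (p := LinearMap.range Tf) p ⊗ₜ[ℂ]
            Submodule.Quotient.mk (p := LinearMap.range Tg) q) =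
          Submodule.Quotient.mk (p := LinearMap.range D₁)
            (Polynomial.aeval (X (0 : Fin 2)) p * Polynomial.aeval (X (1 : Fin 2)) q)) ∧
    finrank ℂ (MvPolynomial (Fin 2) ℂ ⧸ LinearMap.range D₁) =
      (f.natDegree - 1) * (g.natDegree - 1) := by
  set Φ := polynomialTensorEquiv ℂ
  have hX (t : Polynomial ℂ ⊗[ℂ] Polynomial ℂ) : Φ (Tf.rTensor _ t) =
      pderiv (0 : Fin 2) (Φ t) + Polynomial.aeval (X (0 : Fin 2)) (derivative f) * Φ t := by
    induction t with
    | zero => simp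
    | add s t hs ht => simp only [map_add, hs, ht]; ring
    | tmul p q =>
      simp only [Φ, LinearMap.rTensor_tmul, polynomialTensorEquiv_tmul, hTf, Derivation.leibniz,
        MvPolynomial.pderiv_aeval_X, map_add, map_mul, smul_eq_mul]
      simp
      ring
  have hY (t : Polynomial ℂ ⊗[ℂ] Polynomial ℂ) : Φ (Tg.lTensor _ t) =
      pderiv (1 : Fin 2) (Φ t) + Polynomial.aeval (X (1 : Fin 2)) (derivative g) * Φ t := by
    induction t with
    | zero => simp
    | add s t hs ht => simp only [map_add, hs, ht]; ring
    | tmul p q =>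
      simp only [Φ, LinearMap.lTensor_tmul, polynomialTensorEquiv_tmul, hTg, Derivation.leibniz,
        MvPolynomial.pderiv_aeval_X, map_add, map_mul, smul_eq_mul]
      simp
      ring
  have hD (s t : Polynomial ℂ ⊗[ℂ] Polynomial ℂ) :
      D₁ (Φ s, Φ t) = Φ (Tf.rTensor _ t - Tg.lTensor _ s) := by
    rw [hD₁, map_sub, hX, hY]
  have hrange : (LinearMap.range (TensorProduct.map (LinearMap.range Tf).subtype LinearMap.id) ⊔
      LinearMap.range (TensorProduct.map LinearMap.id (LinearMap.range Tg).subtype)).map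
        (Φ : _ →ₗ[ℂ] MvPolynomial (Fin 2) ℂ) = LinearMap.range D₁ := by
    have hr : LinearMap.range (TensorProduct.map (LinearMap.range Tf).subtype
        (LinearMap.id : Polynomial ℂ →ₗ[ℂ] Polynomial ℂ)) =
        LinearMap.range (Tf.rTensor (Polynomial ℂ)) :=
      (LinearMap.rTensor_range (Polynomial ℂ)).symm
    have hl : LinearMap.range (TensorProduct.map
        (LinearMap.id : Polynomial ℂ →ₗ[ℂ] Polynomial ℂ) (LinearMap.range Tg).subtype) =
        LinearMap.range (Tg.lTensor (Polynomial ℂ)) :=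
      (LinearMap.lTensor_range (Polynomial ℂ)).symm
    rw [hr, hl]
    ext z
    simp only [Submodule.mem_map, Submodule.mem_sup, LinearMap.mem_range]
    constructor
    · rintro ⟨_, ⟨_, ⟨t, rfl⟩, _, ⟨s, rfl⟩, rfl⟩, rfl⟩
      refine ⟨(Φ (-s), Φ t), ?_⟩
      rw [hD]
      simp
    · rintro ⟨⟨h₁, h₂⟩, rfl⟩
      obtain ⟨s, rfl⟩ := Φ.surjective h₁
      obtain ⟨t, rfl⟩ := Φ.surjective h₂
      refine ⟨_, ⟨_, ⟨t, rfl⟩, _, ⟨-s, rfl⟩, rfl⟩, ?_⟩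
      rw [hD]
      simp [sub_eq_add_neg]
  let e := (quotientTensorQuotientEquiv (LinearMap.range Tf) (LinearMap.range Tg)).trans
    (Submodule.Quotient.equiv _ _ Φ hrange)
  refine ⟨⟨e, fun p q => ?_⟩, ?_⟩
  · rw [← polynomialTensorEquiv_tmul]
    rfl
  · have hne {h : Polynomial ℂ} (hh : 1 ≤ h.natDegree) : derivative h ≠ 0 := fun h0 => by
      have := Polynomial.derivative_eq_zero.mp h0
      lia
    rw [← e.finrank_eq, finrank_tensorProduct,
      finrank_quotient_range_derivative_add_mul (hne hf) Tf hTf,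
      finrank_quotient_range_derivative_add_mul (hne hg) Tg hTg,
      natDegree_derivative, natDegree_derivative]
end

section
/- Let A = ℂ[x, y] and define D₀ : A → A × A, D₀(h) = (∂ₓh + 2x·h, ∂ᵧh + 2y·h), and D₁ : A × A → A, D₁(h₁, h₂) = (∂ₓh₂ + 2x·h₂) − (∂ᵧh₁ + 2y·h₁). Then D₀ is injective, the kernel of D₁ equals the range of D₀, and the quotient A/range(D₁) is one-dimensional over ℂ, spanned by the class of the constant polynomial 1. -/
open MvPolynomial Module

section TwistedPDeriv

variable {σ K : Type*} [Field K] [CharZero K]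

theorem pderiv_comm_apply {R : Type*} [CommSemiring R] (i j : σ) (p : MvPolynomial σ R) :
    pderiv i (pderiv j p) = pderiv j (pderiv i p) := by
  classical
  obtain rfl | h := eq_or_ne i j
  · rfl
  · ext m
    simp only [coeff_pderiv, Finsupp.add_apply, Finsupp.single_eq_of_ne h,
      Finsupp.single_eq_of_ne h.symm, add_zero]
    rw [add_right_comm m]
    ring

theorem pderiv_twisted_of_ne {R : Type*} [CommSemiring R] {i j : σ}
    (hij : j ≠ i) (q : MvPolynomial σ R) :
    pderiv j (pderiv i q + 2 * X i * q) = pderiv i (pderiv j q) + 2 * X i * pderiv j q := by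
  have h2 : pderiv j (2 : MvPolynomial σ R) = 0 := by
    rw [← map_ofNat C 2, pderiv_C]
  simp only [map_add, pderiv_mul, h2, pderiv_X_of_ne hij.symm, pderiv_comm_apply j i]
  ring

theorem coeff_eq_zero_of_pderiv_eq_zero {i : σ} {p : MvPolynomial σ K} (hp : pderiv i p = 0)
    {m : σ →₀ ℕ} (hm : m i ≠ 0) : coeff m p = 0 := by
  have h := coeff_pderiv p (m - Finsupp.single i 1) (i := i)
  rw [hp, coeff_zero, Finsupp.sub_add_single_one_cancel hm] at h
  exact (mul_eq_zero.mp h.symm).resolve_right (Nat.cast_add_one_ne_zero _)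

/-- The decomposition `p = (∂ᵢq + 2xᵢq) + r` with `∂ᵢr = 0` is unique. -/
theorem eq_zero_of_twisted_add_eq_zero {i : σ} {q r : MvPolynomial σ K}
    (hr : pderiv i r = 0) (h : pderiv i q + 2 * X i * q + r = 0) : q = 0 ∧ r = 0 := by
  classical
  have hq : q = 0 := by
    by_contra hne
    obtain ⟨m, hm, hmax⟩ := q.support.exists_max_image (fun m => m i) (support_nonempty.mpr hne)
    have htop : coeff (m + Finsupp.single i 1 + Finsupp.single i 1) q = 0 := by
      by_contra hc
      have := hmax _ (mem_support_iff.mpr hc)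
      simp at this
    have hc := congrArg (coeff (m + Finsupp.single i 1)) h
    have h2 : (2 * X i * q : MvPolynomial σ K) = C 2 * (q * X i) := by
      rw [map_ofNat]
      ring
    rw [coeff_add, coeff_add, coeff_pderiv, htop, h2, coeff_C_mul, coeff_mul_X,
      coeff_eq_zero_of_pderiv_eq_zero hr (by simp)] at hc
    exact mem_support_iff.mp hm (by simpa using hc)
  subst hq
  exact ⟨rfl, by simpa using h⟩

theorem two_mul_C_inv_two : (2 * C 2⁻¹ : MvPolynomial σ K) = 1 := by
  rw [← map_ofNat C 2, ← C_mul, mul_inv_cancel₀ two_ne_zero, C_1]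

theorem exists_twisted_add_mul_X_pow {i : σ} {s : MvPolynomial σ K} (hs : pderiv i s = 0) :
    ∀ n : ℕ, ∃ q r : MvPolynomial σ K,
      pderiv i r = 0 ∧ s * X i ^ n = pderiv i q + 2 * X i * q + r
  | 0 => ⟨0, s, hs, by simp⟩
  | 1 => by
    refine ⟨C 2⁻¹ * s, 0, map_zero _, ?_⟩
    rw [pderiv_C_mul, hs]
    linear_combination (-s * X i) * two_mul_C_inv_two (σ := σ) (K := K)
  | n + 2 => by
    obtain ⟨q, r, hr, h⟩ := exists_twisted_add_mul_X_pow hs n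
    refine ⟨C 2⁻¹ * (s * X i ^ (n + 1)) - C (2⁻¹ * (n + 1) : K) * q,
      -(C (2⁻¹ * (n + 1) : K) * r), ?_, ?_⟩
    · rw [map_neg, pderiv_C_mul, hr, mul_zero, neg_zero]
    · rw [map_sub, pderiv_C_mul, pderiv_C_mul]
      simp only [pderiv_mul, pderiv_pow, pderiv_X_self, hs, C_mul, C_add,
        C_1, map_natCast, Nat.add_sub_cancel, Nat.cast_add, Nat.cast_one]
      linear_combination (-s * X i ^ (n + 2)) * two_mul_C_inv_two (σ := σ) (K := K) -
        C 2⁻¹ * ((n : MvPolynomial σ K) + 1) * h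

theorem exists_twisted_add (i : σ) (p : MvPolynomial σ K) :
    ∃ q r : MvPolynomial σ K, pderiv i r = 0 ∧ p = pderiv i q + 2 * X i * q + r := by
  classical
  induction p using MvPolynomial.induction_on' with
  | monomial m a =>
    have hs : pderiv i (monomial (m.erase i) a) = 0 := by simp
    obtain ⟨q, r, hr, h⟩ := exists_twisted_add_mul_X_pow hs (m i)
    exact ⟨q, r, hr, by rw [← h, ← monomial_add_single, Finsupp.erase_add_single]⟩
  | add p₁ p₂ h₁ h₂ =>
    obtain ⟨q₁, r₁, hr₁, rfl⟩ := h₁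
    obtain ⟨q₂, r₂, hr₂, rfl⟩ := h₂
    refine ⟨q₁ + q₂, r₁ + r₂, by rw [map_add, hr₁, hr₂, add_zero], ?_⟩
    rw [map_add]
    ring

theorem eq_C_of_pderiv_eq_zero {p : MvPolynomial σ K} (hp : ∀ i, pderiv i p = 0) :
    p = C (coeff 0 p) := by
  classical
  ext m
  rw [coeff_C]
  split_ifs with hm
  · rw [hm]
  · obtain ⟨i, hi⟩ := Finsupp.ne_iff.mp (Ne.symm hm)
    exact coeff_eq_zero_of_pderiv_eq_zero (hp i) hi

end TwistedPDeriv

open MvPolynomial Module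

/-- Twisted de Rham cohomology of the product pair `(𝔸², x² + y²)`: with
`A = ℂ[x, y]`, `D₀(h) = (∂ₓh + 2xh, ∂ᵧh + 2yh)` and
`D₁(h₁, h₂) = (∂ₓh₂ + 2xh₂) − (∂ᵧh₁ + 2yh₁)`, the map `D₀` is injective,
`ker D₁ = range D₀`, and `A / range D₁` is one-dimensional, spanned by the class
of the constant polynomial `1`; i.e. `H⁰_dR = H¹_dR = 0` and
`H²_dR(𝔸², x² + y²) = ℂ·[dx∧dy]`. -/
theorem twisted_deRham_plane_xsq_ysq
    (D₀ : MvPolynomial (Fin 2) ℂ →ₗ[ℂ] MvPolynomial (Fin 2) ℂ × MvPolynomial (Fin 2) ℂ)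
    (D₁ : MvPolynomial (Fin 2) ℂ × MvPolynomial (Fin 2) ℂ →ₗ[ℂ] MvPolynomial (Fin 2) ℂ)
    (hD₀ : ∀ h : MvPolynomial (Fin 2) ℂ,
      D₀ h = (pderiv (0 : Fin 2) h + 2 * X (0 : Fin 2) * h,
              pderiv (1 : Fin 2) h + 2 * X (1 : Fin 2) * h))
    (hD₁ : ∀ h₁ h₂ : MvPolynomial (Fin 2) ℂ,
      D₁ (h₁, h₂) = (pderiv (0 : Fin 2) h₂ + 2 * X (0 : Fin 2) * h₂) -
                    (pderiv (1 : Fin 2) h₁ + 2 * X (1 : Fin 2) * h₁)) :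
    Function.Injective D₀ ∧ LinearMap.ker D₁ = LinearMap.range D₀ ∧
      finrank ℂ (MvPolynomial (Fin 2) ℂ ⧸ LinearMap.range D₁) = 1 ∧
      Submodule.span ℂ
          {Submodule.Quotient.mk (p := LinearMap.range D₁)
            (1 : MvPolynomial (Fin 2) ℂ)} = ⊤ := by
  have hT₁ : ∀ {r : MvPolynomial (Fin 2) ℂ}, pderiv 0 r = 0 →
      pderiv 0 (pderiv 1 r + 2 * X 1 * r) = 0 := by
    intro r hr
    rw [pderiv_twisted_of_ne (by decide), hr, map_zero, mul_zero, add_zero]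
  have hone : (1 : MvPolynomial (Fin 2) ℂ) ∉ LinearMap.range D₁ := by
    rintro ⟨⟨h₁, h₂⟩, h⟩
    rw [hD₁] at h
    obtain ⟨q, r, hr, rfl⟩ := exists_twisted_add 0 h₁
    have hx := (eq_zero_of_twisted_add_eq_zero (i := 0)
      (q := h₂ - (pderiv 1 q + 2 * X 1 * q)) (r := -(pderiv 1 r + 2 * X 1 * r) - 1)
      (by rw [map_sub, map_neg, hT₁ hr, pderiv_one, neg_zero, sub_zero]) (by
        rw [map_sub, pderiv_twisted_of_ne (show (0 : Fin 2) ≠ 1 by decide)]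
        rw [map_add (pderiv 1), pderiv_twisted_of_ne (show (1 : Fin 2) ≠ 0 by decide)] at h
        linear_combination h + pderiv_comm_apply 0 1 q)).2
    exact one_ne_zero (eq_zero_of_twisted_add_eq_zero (i := 1) (q := r)
      (r := (1 : MvPolynomial (Fin 2) ℂ)) pderiv_one (by linear_combination -hx)).2
  have hspan : ∀ w : MvPolynomial (Fin 2) ℂ ⧸ LinearMap.range D₁,
      ∃ c : ℂ, c • Submodule.Quotient.mk (p := LinearMap.range D₁)
        (1 : MvPolynomial (Fin 2) ℂ) = w := by
    intro w
    obtain ⟨p, rfl⟩ := Submodule.Quotient.mk_surjective _ w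
    obtain ⟨q, r, hr, rfl⟩ := exists_twisted_add 0 p
    obtain ⟨s, t, ht, rfl⟩ := exists_twisted_add 1 r
    have ht₀ : pderiv 0 t = 0 := by
      rw [map_add, pderiv_twisted_of_ne (by decide)] at hr
      exact (eq_zero_of_twisted_add_eq_zero
        (by rw [pderiv_comm_apply, ht, map_zero]) hr).2
    have htC : t = C (coeff 0 t) :=
      eq_C_of_pderiv_eq_zero (Fin.forall_fin_two.mpr ⟨ht₀, ht⟩)
    refine ⟨coeff 0 t, ?_⟩
    rw [← Submodule.Quotient.mk_smul, Submodule.Quotient.eq, smul_eq_C_mul, mul_one, ← htC]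
    refine ⟨(s, -q), ?_⟩
    rw [hD₁, map_neg]
    ring
  refine ⟨?_, ?_, ?_, ?_⟩
  · rw [injective_iff_map_eq_zero]
    intro h hh
    rw [hD₀, Prod.mk_eq_zero] at hh
    exact (eq_zero_of_twisted_add_eq_zero (map_zero (pderiv (0 : Fin 2)))
      (by rw [hh.1, add_zero])).1
  · ext ⟨h₁, h₂⟩
    rw [LinearMap.mem_ker, LinearMap.mem_range, hD₁]
    constructor
    · intro h
      obtain ⟨q, r, hr, rfl⟩ := exists_twisted_add 0 h₁
      obtain ⟨hx, hy⟩ := eq_zero_of_twisted_add_eq_zero (i := 0)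
        (q := h₂ - (pderiv 1 q + 2 * X 1 * q)) (r := -(pderiv 1 r + 2 * X 1 * r))
        (by rw [map_neg, hT₁ hr, neg_zero]) (by
          rw [map_sub, pderiv_twisted_of_ne (show (0 : Fin 2) ≠ 1 by decide)]
          rw [map_add (pderiv 1), pderiv_twisted_of_ne (show (1 : Fin 2) ≠ 0 by decide)] at h
          linear_combination h + pderiv_comm_apply 0 1 q)
      have hr₀ : r = 0 := (eq_zero_of_twisted_add_eq_zero (map_zero (pderiv (1 : Fin 2)))
        (by rw [neg_eq_zero.mp hy, add_zero])).1
      exact ⟨q, by rw [hD₀, hr₀, add_zero, sub_eq_zero.mp hx]⟩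
    · rintro ⟨q, hq⟩
      rw [hD₀, Prod.mk.injEq] at hq
      obtain ⟨rfl, rfl⟩ := hq
      rw [pderiv_twisted_of_ne (show (1 : Fin 2) ≠ 0 by decide),
        pderiv_twisted_of_ne (show (0 : Fin 2) ≠ 1 by decide), pderiv_comm_apply 1 0]
      ring
  · exact finrank_eq_one _ (fun h => hone ((Submodule.Quotient.mk_eq_zero _).mp h)) hspan
  · exact eq_top_iff.mpr fun w _ => Submodule.mem_span_singleton.mpr (hspan w)
end
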